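/- Let f, g ∈ ℂ[x] with g monic of degree m. Writing Θ_{f,g}(x,y) = Σ_{i=0}^{m−1} κ_{f,g,i}(x) y^i and Θ_{1,g}(x,y) = Σ_{i=0}^{m−1} H_{g,i}(x) y^i, one has for every i ∈ {0, …, m−1} the congruence κ_{f,g,i}(x) ≡ f(x)·H_{g,i}(x) mod g(x); consequently the Bézout matrix B_{f,g} represents multiplication by f on ℂ[x]/(g) from the Horner basis to the monomial basis. -/

import Mathlib

open Polynomial

/-- Let `f, g ∈ ℂ[x]` with `g` monic of degree `m` and `deg f ≤ m`.  Writing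
`Θ_{f,g}(x,y) = Σ_i κ_{f,g,i}(x) y^i` and `Θ_{1,g}(x,y) = Σ_i H_{g,i}(x) y^i`
(where `Θ_{f,g}(x,y) = (f(x)g(y) − f(y)g(x))/(x − y)` is the Bézout bivariate polynomial,
an element of `(ℂ[x])[y]` characterized by `Θ_{f,g}·(x − y) = f(x)g(y) − f(y)g(x)`),
one has for every `i` the congruence `κ_{f,g,i}(x) ≡ f(x)·H_{g,i}(x) mod g(x)`;
consequently the Bézout matrix `B_{f,g}` represents multiplication by `f` on `ℂ[x]/(g)`
from the Horner basis to the monomial basis. -/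
theorem bezout_coeff_congruence (m : ℕ) (f g : ℂ[X]) (hg : g.Monic)
    (hm : g.natDegree = m) (hf : f.natDegree ≤ m)
    (Θfg Θ1g : Polynomial (Polynomial ℂ))
    (h1 : Θfg * (Polynomial.C X - X) = Polynomial.C f * g.map Polynomial.C
            - Polynomial.C g * f.map Polynomial.C)
    (h2 : Θ1g * (Polynomial.C X - X) = g.map Polynomial.C - Polynomial.C g) :
    ∀ i : ℕ, g ∣ (Θfg.coeff i - f * Θ1g.coeff i) := by
  have hev : (f.map Polynomial.C).eval (X : ℂ[X]) = f := by
    rw [Polynomial.eval_map]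
    exact Polynomial.eval₂_C_X
  obtain ⟨q, hq⟩ := Polynomial.X_sub_C_dvd_sub_C_eval (a := (X : ℂ[X])) (p := f.map Polynomial.C)
  rw [hev] at hq
  have hne : (Polynomial.C X - X : Polynomial (Polynomial ℂ)) ≠ 0 := by
    rw [← neg_sub]
    exact neg_ne_zero.mpr (Polynomial.X_sub_C_ne_zero _)
  have key : Θfg - Polynomial.C f * Θ1g = Polynomial.C g * q := by
    apply mul_right_cancel₀ hne
    linear_combination h1 - Polynomial.C f * h2 - Polynomial.C g * hq
  intro i
  refine ⟨q.coeff i, ?_⟩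
  have := congrArg (fun p => Polynomial.coeff p i) key
  simpa [Polynomial.coeff_C_mul] using this
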